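/- Suppose that for every integer n ≥ 0 one has α ≠ −(1/(q − q⁻¹))·((q^{−2m}(1 − q^{−2nm})/(1 − q^{−2m}))·β^m − (q^{2m}(1 − q^{2nm})/(1 − q^{2m}))·γ^m), and that for every integer n ≥ 1 one has α ≠ (1/(q − q⁻¹))·(((1 − q^{2nm})/(1 − q^{2m}))·β^m − ((1 − q^{−2nm})/(1 − q^{−2m}))·γ^m). Then the left U-module U/P_{∞,∞}, where P_{∞,∞} = U(EF − α) + U(K − β) + U(H − γ), is an infinite-dimensional irreducible (simple) representation of U on which K and H act semisimply. -/

import Mathlib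

set_option synthInstance.maxHeartbeats 1000000
set_option maxHeartbeats 1000000

noncomputable section

open FreeAlgebra

/-- Generators of the quantum group `U_q(f(K,H))`. -/
inductive Gen : Type
  | E | F | K | Kinv | H | Hinv

/-- The free algebra on the generators. -/
abbrev FA : Type := FreeAlgebra ℂ Gen

def gE : FA := ι ℂ Gen.E
def gF : FA := ι ℂ Gen.F
def gK : FA := ι ℂ Gen.K
def gKi : FA := ι ℂ Gen.Kinv
def gH : FA := ι ℂ Gen.H
def gHi : FA := ι ℂ Gen.Hinv

/-- The defining relations of `U_q(f(K,H))`, where `r` is the element of the free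
algebra representing the Laurent polynomial `f(K,H)` appearing in `EF - FE = f(K,H)`. -/
inductive URel (q : ℂ) (r : FA) : FA → FA → Prop
  | KKi : URel q r (gK * gKi) 1
  | KiK : URel q r (gKi * gK) 1
  | HHi : URel q r (gH * gHi) 1
  | HiH : URel q r (gHi * gH) 1
  | KH  : URel q r (gK * gH) (gH * gK)
  | KE  : URel q r (gK * gE) (q ^ 2 • (gE * gK))
  | KF  : URel q r (gK * gF) ((q ^ 2)⁻¹ • (gF * gK))
  | HE  : URel q r (gH * gE) ((q ^ 2)⁻¹ • (gE * gH))
  | HF  : URel q r (gH * gF) (q ^ 2 • (gF * gH))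
  | EF  : URel q r (gE * gF - gF * gE) r

/-- `U_q(f(K,H))` as a quotient of the free algebra. -/
abbrev Uq (q : ℂ) (r : FA) : Type := RingQuot (URel q r)

variable (q : ℂ) (r : FA)

def uE : Uq q r := RingQuot.mkAlgHom ℂ (URel q r) gE
def uF : Uq q r := RingQuot.mkAlgHom ℂ (URel q r) gF
def uK : Uq q r := RingQuot.mkAlgHom ℂ (URel q r) gK
def uKi : Uq q r := RingQuot.mkAlgHom ℂ (URel q r) gKi
def uH : Uq q r := RingQuot.mkAlgHom ℂ (URel q r) gH
def uHi : Uq q r := RingQuot.mkAlgHom ℂ (URel q r) gHi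

/-- The element `f_m(K,H) = (K^m - H^m)/(q - q⁻¹)` of the free algebra. -/
def fm (q : ℂ) (m : ℕ) : FA := (q - q⁻¹)⁻¹ • (gK ^ m - gH ^ m)

/-- The quantum group `U_q(f_m(K,H))`. -/
abbrev Um (q : ℂ) (m : ℕ) : Type := Uq q (fm q m)

end
/-- The left ideal `P_{1,n+1} = U(EF - α) + U(K - β) + U(H - γ) + UE + UF^{n+1}`. -/
noncomputable def P1n (q : ℂ) (m : ℕ) (α β γ : ℂ) (n : ℕ) :
    Submodule (Um q m) (Um q m) :=
  Submodule.span (Um q m)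
    {uE q (fm q m) * uF q (fm q m) - algebraMap ℂ (Um q m) α,
     uK q (fm q m) - algebraMap ℂ (Um q m) β,
     uH q (fm q m) - algebraMap ℂ (Um q m) γ,
     uE q (fm q m),
     uF q (fm q m) ^ (n + 1)}

/-- The left ideal `P_{1,∞} = U(EF - α) + U(K - β) + U(H - γ) + UE`. -/
noncomputable def P1inf (q : ℂ) (m : ℕ) (α β γ : ℂ) :
    Submodule (Um q m) (Um q m) :=
  Submodule.span (Um q m)
    {uE q (fm q m) * uF q (fm q m) - algebraMap ℂ (Um q m) α,
     uK q (fm q m) - algebraMap ℂ (Um q m) β,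
     uH q (fm q m) - algebraMap ℂ (Um q m) γ,
     uE q (fm q m)}

/-- The left ideal `P_{∞,1} = U(EF - α) + U(K - β) + U(H - γ) + UF`. -/
noncomputable def Pinf1 (q : ℂ) (m : ℕ) (α β γ : ℂ) :
    Submodule (Um q m) (Um q m) :=
  Submodule.span (Um q m)
    {uE q (fm q m) * uF q (fm q m) - algebraMap ℂ (Um q m) α,
     uK q (fm q m) - algebraMap ℂ (Um q m) β,
     uH q (fm q m) - algebraMap ℂ (Um q m) γ,
     uF q (fm q m)}

/-- The left ideal `P_{∞,∞} = U(EF - α) + U(K - β) + U(H - γ)`. -/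
noncomputable def Pinfinf (q : ℂ) (m : ℕ) (α β γ : ℂ) :
    Submodule (Um q m) (Um q m) :=
  Submodule.span (Um q m)
    {uE q (fm q m) * uF q (fm q m) - algebraMap ℂ (Um q m) α,
     uK q (fm q m) - algebraMap ℂ (Um q m) β,
     uH q (fm q m) - algebraMap ℂ (Um q m) γ}
/-- `u ∈ U` acts semisimply (diagonalizably) on the `U`-module `V`: every vector is a
sum of eigenvectors of `u` (with eigenvalues in `ℂ`). -/
def ActsDiag (q : ℂ) (m : ℕ) (V : Type*) [AddCommGroup V] [Module (Um q m) V]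
    (u : Um q m) : Prop :=
  ∀ v : V, v ∈ AddSubgroup.closure
    {w : V | ∃ a : ℂ, u • w = algebraMap ℂ (Um q m) a • w}
section Relations

variable (q : ℂ) (r : FA)

lemma uKi_mul_uK : uKi q r * uK q r = 1 := by
  simpa [uK, uKi] using RingQuot.mkAlgHom_rel ℂ (URel.KiK (q := q) (r := r))

lemma uHi_mul_uH : uHi q r * uH q r = 1 := by
  simpa [uH, uHi] using RingQuot.mkAlgHom_rel ℂ (URel.HiH (q := q) (r := r))

lemma uK_mul_uE : uK q r * uE q r = q ^ 2 • (uE q r * uK q r) := by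
  simpa [uK, uE] using RingQuot.mkAlgHom_rel ℂ (URel.KE (q := q) (r := r))

lemma uK_mul_uF : uK q r * uF q r = (q ^ 2)⁻¹ • (uF q r * uK q r) := by
  simpa [uK, uF] using RingQuot.mkAlgHom_rel ℂ (URel.KF (q := q) (r := r))

lemma uH_mul_uE : uH q r * uE q r = (q ^ 2)⁻¹ • (uE q r * uH q r) := by
  simpa [uH, uE] using RingQuot.mkAlgHom_rel ℂ (URel.HE (q := q) (r := r))

lemma uH_mul_uF : uH q r * uF q r = q ^ 2 • (uF q r * uH q r) := by
  simpa [uH, uF] using RingQuot.mkAlgHom_rel ℂ (URel.HF (q := q) (r := r))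

lemma uE_mul_uF (m : ℕ) :
    uE q (fm q m) * uF q (fm q m) = uF q (fm q m) * uE q (fm q m) +
      (q - q⁻¹)⁻¹ • (uK q (fm q m) ^ m - uH q (fm q m) ^ m) := by
  have h := RingQuot.mkAlgHom_rel ℂ (URel.EF (q := q) (r := fm q m))
  rw [map_sub, map_mul, map_mul, sub_eq_iff_eq_add'] at h
  have hf : RingQuot.mkAlgHom ℂ (URel q (fm q m)) (fm q m) =
      (q - q⁻¹)⁻¹ • (uK q (fm q m) ^ m - uH q (fm q m) ^ m) := by
    conv_lhs => enter [2]; rw [fm]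
    rw [map_smul, map_sub, map_pow, map_pow, uK, uH]
  rw [uE, uF, h, hf]

end Relations

/-- The eigenvalue of `K` on the weight vectors of degree `k`. -/
noncomputable def wtK (q β : ℂ) (k : ℤ) : ℂ := q ^ (2 * k) * β

/-- The eigenvalue of `H` on the weight vectors of degree `k`. -/
noncomputable def wtH (q γ : ℂ) (k : ℤ) : ℂ := q ^ (-(2 * k)) * γ

/-- The eigenvalue of `EF` on the weight vectors of degree `k`. -/
noncomputable def eigEF (q : ℂ) (m : ℕ) (α β γ : ℂ) (k : ℤ) : ℂ :=
  α - (q - q⁻¹)⁻¹ * ((1 - (q ^ (2 * m)) ^ k) / (1 - q ^ (2 * m)) * β ^ m -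
    (1 - (q ^ (2 * m)) ^ (-k)) / (1 - (q ^ (2 * m))⁻¹) * γ ^ m)

section Weights

variable {q : ℂ} {m : ℕ} {α β γ : ℂ}

lemma wtK_add_one (hq0 : q ≠ 0) (k : ℤ) : wtK q β (k + 1) = q ^ 2 * wtK q β k := by
  rw [wtK, wtK, mul_add, zpow_add₀ hq0]; norm_cast; ring

lemma wtK_sub_one (hq0 : q ≠ 0) (k : ℤ) : wtK q β (k - 1) = (q ^ 2)⁻¹ * wtK q β k := by
  rw [wtK, wtK, mul_sub, zpow_sub₀ hq0]; norm_cast; ring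

lemma wtH_add_one (hq0 : q ≠ 0) (k : ℤ) : wtH q γ (k + 1) = (q ^ 2)⁻¹ * wtH q γ k := by
  rw [wtH, wtH, mul_add, neg_add, zpow_add₀ hq0, mul_one, zpow_neg q 2]; norm_cast; ring

lemma wtH_sub_one (hq0 : q ≠ 0) (k : ℤ) : wtH q γ (k - 1) = q ^ 2 * wtH q γ k := by
  rw [wtH, wtH, mul_sub, neg_sub, sub_eq_add_neg, zpow_add₀ hq0]; norm_cast; ring

lemma wtK_ne_zero (hq0 : q ≠ 0) (hβ : β ≠ 0) (k : ℤ) : wtK q β k ≠ 0 :=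
  mul_ne_zero (zpow_ne_zero _ hq0) hβ

lemma wtH_ne_zero (hq0 : q ≠ 0) (hγ : γ ≠ 0) (k : ℤ) : wtH q γ k ≠ 0 :=
  mul_ne_zero (zpow_ne_zero _ hq0) hγ

lemma wtK_injective (hq0 : q ≠ 0) (hq : ∀ n : ℕ, 0 < n → q ^ n ≠ 1) (hβ : β ≠ 0) :
    Function.Injective (wtK q β) := by
  intro i j h
  have h' : q ^ (2 * i) = q ^ (2 * j) := mul_right_cancel₀ hβ h
  have key : ∀ a b : ℤ, a < b → q ^ (2 * a) ≠ q ^ (2 * b) := by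
    intro a b hab e
    obtain ⟨n, hn⟩ := Int.eq_ofNat_of_zero_le (show 0 ≤ 2 * b - 2 * a by omega)
    refine hq n (by omega) ?_
    rw [← zpow_natCast, ← hn, zpow_sub₀ hq0, e, div_self (zpow_ne_zero _ hq0)]
  rcases lt_trichotomy i j with hij | hij | hij
  · exact (key i j hij h').elim
  · exact hij
  · exact (key j i hij h'.symm).elim

@[simp] lemma wtK_zero : wtK q β 0 = β := by simp [wtK]

@[simp] lemma wtH_zero : wtH q γ 0 = γ := by simp [wtH]

@[simp] lemma eigEF_zero : eigEF q m α β γ 0 = α := by simp [eigEF]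

lemma eigEF_eq_add (hq0 : q ≠ 0) (hm : q ^ (2 * m) ≠ 1) (k : ℤ) :
    eigEF q m α β γ k = eigEF q m α β γ (k + 1) +
      (q - q⁻¹)⁻¹ * (wtK q β k ^ m - wtH q γ k ^ m) := by
  have hQ : q ^ (2 * m) ≠ 0 := pow_ne_zero _ hq0
  have hK : wtK q β k ^ m = (q ^ (2 * m)) ^ k * β ^ m := by
    rw [wtK, mul_pow, ← zpow_natCast, ← zpow_natCast q, ← zpow_mul, ← zpow_mul]
    push_cast; ring_nf
  have hH : wtH q γ k ^ m = ((q ^ (2 * m)) ^ k)⁻¹ * γ ^ m := by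
    rw [wtH, mul_pow, ← zpow_neg, ← zpow_natCast, ← zpow_natCast q, ← zpow_mul, ← zpow_mul]
    push_cast; ring_nf
  rw [hK, hH, eigEF, eigEF, neg_add, zpow_add₀ hQ, zpow_add₀ hQ, zpow_one, zpow_neg, zpow_neg,
    zpow_one]
  have hP : (q ^ (2 * m)) ^ k ≠ 0 := zpow_ne_zero _ hQ
  generalize (q ^ (2 * m)) ^ k = P at *
  generalize q ^ (2 * m) = Q at *
  have h1 : 1 - Q ≠ 0 := sub_ne_zero.2 hm.symm
  have h2 : Q - 1 ≠ 0 := sub_ne_zero.2 hm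
  have e1 : (1 - P * Q) / (1 - Q) = (1 - P) / (1 - Q) + P := by field_simp; ring
  have e2 : (1 - P⁻¹ * Q⁻¹) / (1 - Q⁻¹) = (1 - P⁻¹) / (1 - Q⁻¹) + P⁻¹ := by field_simp; ring
  rw [e1, e2]
  ring

lemma eigEF_ne_zero (hq0 : q ≠ 0) (hm : q ^ (2 * m) ≠ 1)
    (h1 : ∀ n : ℕ,
      α ≠ -((q - q⁻¹)⁻¹ *
        (q ^ (-(2 * (m : ℤ))) * (1 - q ^ (-(2 * (n : ℤ) * m))) / (1 - q ^ (-(2 * (m : ℤ))))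
            * β ^ m -
         q ^ (2 * m) * (1 - q ^ (2 * n * m)) / (1 - q ^ (2 * m)) * γ ^ m)))
    (h2 : ∀ n : ℕ, 1 ≤ n →
      α ≠ (q - q⁻¹)⁻¹ *
        ((1 - q ^ (2 * n * m)) / (1 - q ^ (2 * m)) * β ^ m -
         (1 - q ^ (-(2 * (n : ℤ) * m))) / (1 - q ^ (-(2 * (m : ℤ)))) * γ ^ m)) (k : ℤ) :
    eigEF q m α β γ k ≠ 0 := by
  have hQ : q ^ (2 * m) ≠ 0 := pow_ne_zero _ hq0
  have ea : q ^ (-(2 * (m : ℤ))) = (q ^ (2 * m))⁻¹ := by rw [zpow_neg]; norm_cast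
  have eb (n : ℕ) : q ^ (2 * n * m) = (q ^ (2 * m)) ^ n := by rw [← pow_mul]; ring_nf
  have ec (n : ℕ) : q ^ (-(2 * (n : ℤ) * m)) = ((q ^ (2 * m)) ^ n)⁻¹ := by
    rw [zpow_neg, ← eb]; norm_cast
  simp only [ea, eb, ec] at h1 h2
  intro h
  rw [eigEF, sub_eq_zero] at h
  obtain ⟨n, rfl | rfl⟩ := k.eq_nat_or_neg
  · rcases Nat.eq_zero_or_pos n with rfl | hn
    · exact h1 0 (by simpa using h)
    · exact h2 n hn (by simpa using h)
  · refine h1 n (h.trans ?_)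
    rw [neg_neg, zpow_neg, zpow_natCast]
    generalize (q ^ (2 * m)) ^ n = P at *
    generalize q ^ (2 * m) = Q at *
    have h1 : 1 - Q ≠ 0 := sub_ne_zero.2 hm.symm
    have h2 : Q - 1 ≠ 0 := sub_ne_zero.2 hm
    have e1 : (1 - P⁻¹) / (1 - Q) = -(Q⁻¹ * (1 - P⁻¹) / (1 - Q⁻¹)) := by
      have : 1 - Q = -(Q - 1) := by ring
      rw [this]; field_simp
    have e2 : (1 - P) / (1 - Q⁻¹) = -(Q * (1 - P) / (1 - Q)) := by
      have : 1 - Q = -(Q - 1) := by ring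
      rw [this]; field_simp
    rw [e1, e2]
    ring

end Weights

section WeightVectors

variable {q : ℂ} {m : ℕ} {α β γ : ℂ}
variable {V : Type*} [AddCommGroup V] [Module ℂ V] [Module (Um q m) V]

/-- `v` is a weight vector of degree `k`: a joint eigenvector of `K`, `H` and `EF`. -/
structure IsWeight (α β γ : ℂ) (k : ℤ) (v : V) : Prop where
  smul_K : uK q (fm q m) • v = wtK q β k • v
  smul_H : uH q (fm q m) • v = wtH q γ k • v
  smul_EF : uE q (fm q m) • uF q (fm q m) • v = eigEF q m α β γ k • v

variable [IsScalarTower ℂ (Um q m) V]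

lemma pow_smul_of_eigen {u : Um q m} {v : V} {a : ℂ} (h : u • v = a • v) (n : ℕ) :
    u ^ n • v = a ^ n • v := by
  have := IsScalarTower.to_smulCommClass (R := ℂ) (A := Um q m) (M := V)
  induction n with
  | zero => simp
  | succ n ih => rw [pow_succ, mul_smul, h, smul_comm, ih, smul_smul, pow_succ']

namespace IsWeight

lemma smul {k : ℤ} {v : V} (h : IsWeight (q := q) (m := m) α β γ k v) (a : ℂ) :
    IsWeight (q := q) (m := m) α β γ k (a • v) := by
  have := IsScalarTower.to_smulCommClass (R := ℂ) (A := Um q m) (M := V)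
  exact ⟨by rw [smul_comm, h.smul_K, smul_comm], by rw [smul_comm, h.smul_H, smul_comm],
    by rw [smul_comm _ a, smul_comm _ a, h.smul_EF, smul_comm]⟩

lemma smul_FE {k : ℤ} {v : V} (hq0 : q ≠ 0) (hm : q ^ (2 * m) ≠ 1)
    (h : IsWeight (q := q) (m := m) α β γ k v) :
    uF q (fm q m) • uE q (fm q m) • v = eigEF q m α β γ (k + 1) • v := by
  have e := h.smul_EF
  rw [smul_smul, uE_mul_uF, add_smul, mul_smul, smul_assoc, sub_smul,
    pow_smul_of_eigen h.smul_K, pow_smul_of_eigen h.smul_H, eigEF_eq_add hq0 hm, add_smul,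
    ← sub_smul, smul_smul _ (_ : ℂ), mul_smul] at e
  exact add_right_cancel e

lemma smul_E {k : ℤ} {v : V} (hq0 : q ≠ 0) (hm : q ^ (2 * m) ≠ 1)
    (h : IsWeight (q := q) (m := m) α β γ k v) :
    IsWeight (q := q) (m := m) α β γ (k + 1) (uE q (fm q m) • v) := by
  have := IsScalarTower.to_smulCommClass (R := ℂ) (A := Um q m) (M := V)
  refine ⟨?_, ?_, ?_⟩
  · rw [smul_smul, uK_mul_uE, smul_assoc, mul_smul, h.smul_K, smul_comm _ (_ : ℂ), smul_smul,
      wtK_add_one hq0]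
  · rw [smul_smul, uH_mul_uE, smul_assoc, mul_smul, h.smul_H, smul_comm _ (_ : ℂ), smul_smul,
      wtH_add_one hq0]
  · rw [h.smul_FE hq0 hm, smul_comm]

lemma smul_F {k : ℤ} {v : V} (hq0 : q ≠ 0) (hm : q ^ (2 * m) ≠ 1)
    (h : IsWeight (q := q) (m := m) α β γ k v) :
    IsWeight (q := q) (m := m) α β γ (k - 1) (uF q (fm q m) • v) := by
  have := IsScalarTower.to_smulCommClass (R := ℂ) (A := Um q m) (M := V)
  have hK : uK q (fm q m) • uF q (fm q m) • v = wtK q β (k - 1) • uF q (fm q m) • v := by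
    rw [smul_smul, uK_mul_uF, smul_assoc, mul_smul, h.smul_K, smul_comm _ (_ : ℂ), smul_smul,
      wtK_sub_one hq0]
  have hH : uH q (fm q m) • uF q (fm q m) • v = wtH q γ (k - 1) • uF q (fm q m) • v := by
    rw [smul_smul, uH_mul_uF, smul_assoc, mul_smul, h.smul_H, smul_comm _ (_ : ℂ), smul_smul,
      wtH_sub_one hq0]
  refine ⟨hK, hH, ?_⟩
  rw [smul_smul, uE_mul_uF, add_smul, mul_smul, h.smul_EF, smul_assoc, sub_smul,
    pow_smul_of_eigen hK, pow_smul_of_eigen hH, eigEF_eq_add hq0 hm (k - 1), sub_add_cancel,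
    add_smul, ← sub_smul, smul_smul, smul_comm]

end IsWeight

/-- A family of weight vectors of all degrees, linked by `E` and `F`. -/
structure IsWeightFamily (α β γ : ℂ) (x : ℤ → V) : Prop where
  isWeight : ∀ k, IsWeight (q := q) (m := m) α β γ k (x k)
  smul_E : ∀ k, uE q (fm q m) • x k = x (k + 1)
  smul_F : ∀ k, uF q (fm q m) • x k = eigEF q m α β γ k • x (k - 1)

lemma exists_isWeightFamily (hq0 : q ≠ 0) (hm : q ^ (2 * m) ≠ 1)
    (hc : ∀ k, eigEF q m α β γ k ≠ 0) {w : V} (hw : IsWeight (q := q) (m := m) α β γ 0 w) :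
    ∃ x : ℤ → V, x 0 = w ∧ IsWeightFamily (q := q) (m := m) α β γ x := by
  have := IsScalarTower.to_smulCommClass (R := ℂ) (A := Um q m) (M := V)
  let y : ℕ → V := fun n => uE q (fm q m) ^ n • w
  let z : ℕ → V := fun n => Nat.rec w
    (fun n v => (eigEF q m α β γ (-(n : ℤ)))⁻¹ • uF q (fm q m) • v) n
  have hy0 : y 0 = w := by simp [y]
  have hy : ∀ n : ℕ, uE q (fm q m) • y n = y (n + 1) := fun n => by
    simp only [y, pow_succ', mul_smul]
  have hz : ∀ n : ℕ, uF q (fm q m) • z n = eigEF q m α β γ (-(n : ℤ)) • z (n + 1) := fun n => by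
    change _ = _ • (eigEF q m α β γ (-(n : ℤ)))⁻¹ • uF q (fm q m) • z n
    rw [smul_inv_smul₀ (hc _)]
  have hwy : ∀ n : ℕ, IsWeight (q := q) (m := m) α β γ n (y n) := by
    intro n
    induction n with
    | zero => simpa [y] using hw
    | succ n ih => rw [← hy, Nat.cast_succ]; exact ih.smul_E hq0 hm
  have hwz : ∀ n : ℕ, IsWeight (q := q) (m := m) α β γ (-(n : ℤ)) (z n) := by
    intro n
    induction n with
    | zero => simpa [z] using hw
    | succ n ih =>
      rw [Nat.cast_succ, neg_add, ← sub_eq_add_neg]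
      exact (ih.smul_F hq0 hm).smul _
  let x : ℤ → V := fun k => Int.rec y (fun n => z (n + 1)) k
  have hxy : ∀ n : ℕ, x n = y n := fun n => rfl
  have hxz : ∀ n : ℕ, x (-(n : ℤ)) = z n := fun n => by
    cases n with
    | zero => exact hy0
    | succ n => rfl
  have hx : ∀ k, IsWeight (q := q) (m := m) α β γ k (x k) := by
    intro k
    obtain ⟨n, rfl | rfl⟩ := k.eq_nat_or_neg
    · exact hwy n
    · rw [hxz]; exact hwz n
  refine ⟨x, hy0, hx, ?_, ?_⟩
  · intro k
    obtain ⟨n, rfl | rfl⟩ := k.eq_nat_or_neg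
    · exact hy n
    · cases n with
      | zero => exact hy 0
      | succ n =>
        have e : -((n + 1 : ℕ) : ℤ) + 1 = -(n : ℤ) := by push_cast; ring
        rw [e, hxz, hxz]
        apply smul_right_injective V (hc (-(n : ℤ)))
        change _ • uE q (fm q m) • z (n + 1) = _ • z n
        rw [smul_comm, ← hz, (hwz n).smul_EF]
  · intro k
    obtain ⟨n, rfl | rfl⟩ := k.eq_nat_or_neg
    · cases n with
      | zero => rw [Nat.cast_zero, ← neg_zero, ← Nat.cast_zero, hxz, hz]; rfl
      | succ n =>
        rw [hxy, ← hy, (hwy n).smul_FE hq0 hm, Nat.cast_succ, add_sub_cancel_right, hxy]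
    · have e : -(n : ℤ) - 1 = -((n + 1 : ℕ) : ℤ) := by push_cast; ring
      rw [e, hxz, hxz, hz]

/-- A complex subspace stable under the generators is stable under the whole algebra. -/
lemma smul_mem_of_generators {p : Submodule ℂ V}
    (hE : ∀ v ∈ p, uE q (fm q m) • v ∈ p) (hF : ∀ v ∈ p, uF q (fm q m) • v ∈ p)
    (hK : ∀ v ∈ p, uK q (fm q m) • v ∈ p) (hKi : ∀ v ∈ p, uKi q (fm q m) • v ∈ p)
    (hH : ∀ v ∈ p, uH q (fm q m) • v ∈ p) (hHi : ∀ v ∈ p, uHi q (fm q m) • v ∈ p)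
    (u : Um q m) {v : V} (hv : v ∈ p) : u • v ∈ p := by
  obtain ⟨a, rfl⟩ := RingQuot.mkAlgHom_surjective ℂ (URel q (fm q m)) u
  induction a using FreeAlgebra.induction generalizing v with
  | grade0 c => rw [AlgHom.commutes, algebraMap_smul]; exact p.smul_mem c hv
  | grade1 g =>
    cases g
    exacts [hE v hv, hF v hv, hK v hv, hKi v hv, hH v hv, hHi v hv]
  | mul a b iha ihb => rw [map_mul, mul_smul]; exact iha (ihb hv)
  | add a b iha ihb => rw [map_add, add_smul]; exact p.add_mem (iha hv) (ihb hv)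

/-- A stable subspace that contains a sum of weight vectors of distinct degrees contains each
summand. -/
lemma smul_mem_of_sum_mem (hinj : Function.Injective (wtK q β)) {x : ℤ → V}
    (hx : ∀ k, uK q (fm q m) • x k = wtK q β k • x k) (N : Submodule (Um q m) V)
    (s : Finset ℤ) (a : ℤ → ℂ) (h : ∑ k ∈ s, a k • x k ∈ N) :
    ∀ k ∈ s, a k • x k ∈ N := by
  have := IsScalarTower.to_smulCommClass (R := ℂ) (A := Um q m) (M := V)
  induction s using Finset.induction_on generalizing a with
  | empty => simp
  | insert j s hj ih =>
    have key : ∑ k ∈ s, (a k * (wtK q β k - wtK q β j)) • x k ∈ N := by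
      have e : ∑ k ∈ s, (a k * (wtK q β k - wtK q β j)) • x k =
          uK q (fm q m) • (∑ k ∈ insert j s, a k • x k) -
            wtK q β j • ∑ k ∈ insert j s, a k • x k := by
        rw [Finset.smul_sum, Finset.smul_sum, ← Finset.sum_sub_distrib, Finset.sum_insert hj,
          smul_comm, hx, smul_comm (a j), sub_self, zero_add]
        refine Finset.sum_congr rfl fun k _ => ?_
        rw [smul_comm, hx, smul_smul, smul_smul, ← sub_smul]
        ring_nf
      rw [e]
      exact N.sub_mem (N.smul_mem _ h) (N.smul_of_tower_mem _ h)
    have hs : ∀ k ∈ s, a k • x k ∈ N := by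
      intro k hk
      have hne : wtK q β k - wtK q β j ≠ 0 :=
        sub_ne_zero.2 fun e => hj (hinj e ▸ hk)
      have := N.smul_of_tower_mem (wtK q β k - wtK q β j)⁻¹ (ih _ key k hk)
      rwa [smul_smul, mul_comm (a k), inv_mul_cancel_left₀ hne] at this
    intro k hk
    rcases Finset.mem_insert.1 hk with rfl | hk
    · rw [Finset.sum_insert hj] at h
      exact (N.add_mem_iff_left (N.sum_mem hs)).1 h
    · exact hs k hk

namespace IsWeightFamily

variable {x : ℤ → V}

lemma span_eq_top (hq0 : q ≠ 0) (hβ : β ≠ 0) (hγ : γ ≠ 0)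
    (hx : IsWeightFamily (q := q) (m := m) α β γ x)
    (hgen : ∀ v : V, ∃ u : Um q m, v = u • x 0) : Submodule.span ℂ (Set.range x) = ⊤ := by
  have := IsScalarTower.to_smulCommClass (R := ℂ) (A := Um q m) (M := V)
  have stable (u : Um q m) (hu : ∀ k, u • x k ∈ Submodule.span ℂ (Set.range x)) :
      ∀ v ∈ Submodule.span ℂ (Set.range x), u • v ∈ Submodule.span ℂ (Set.range x) := by
    intro v hv
    induction hv using Submodule.span_induction with
    | mem v hv => obtain ⟨k, rfl⟩ := hv; exact hu k
    | zero => simp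
    | add v w _ _ hv hw => rw [smul_add]; exact add_mem hv hw
    | smul a v _ hv => rw [smul_comm]; exact Submodule.smul_mem _ _ hv
  have mem (k : ℤ) : x k ∈ Submodule.span ℂ (Set.range x) := Submodule.subset_span ⟨k, rfl⟩
  have inv_mem {u u' : Um q m} (h : u' * u = 1) {k : ℤ} {a : ℂ} (ha : a ≠ 0)
      (hu : u • x k = a • x k) : u' • x k ∈ Submodule.span ℂ (Set.range x) := by
    have e : x k = a • u' • x k := by rw [smul_comm, ← hu, smul_smul, h, one_smul]
    rw [← inv_smul_smul₀ ha (u' • x k), ← e]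
    exact Submodule.smul_mem _ _ (mem k)
  refine eq_top_iff.2 fun v _ => ?_
  obtain ⟨u, rfl⟩ := hgen v
  refine smul_mem_of_generators (stable _ fun k => ?_) (stable _ fun k => ?_)
    (stable _ fun k => ?_) (stable _ fun k => ?_) (stable _ fun k => ?_) (stable _ fun k => ?_)
    u (mem 0)
  · rw [hx.smul_E]; exact mem _
  · rw [hx.smul_F]; exact Submodule.smul_mem _ _ (mem _)
  · rw [(hx.isWeight k).smul_K]; exact Submodule.smul_mem _ _ (mem _)
  · exact inv_mem (uKi_mul_uK _ _) (wtK_ne_zero hq0 hβ k) (hx.isWeight k).smul_K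
  · rw [(hx.isWeight k).smul_H]; exact Submodule.smul_mem _ _ (mem _)
  · exact inv_mem (uHi_mul_uH _ _) (wtH_ne_zero hq0 hγ k) (hx.isWeight k).smul_H

/-- A submodule containing one member of the family contains all of them. -/
lemma mem_of_mem (hx : IsWeightFamily (q := q) (m := m) α β γ x)
    (hc : ∀ k, eigEF q m α β γ k ≠ 0) (N : Submodule (Um q m) V) {k : ℤ} (hk : x k ∈ N)
    (l : ℤ) : x l ∈ N := by
  induction l using Int.inductionOn' (b := k) with
  | zero => exact hk
  | succ l _ ih => rw [← hx.smul_E]; exact N.smul_mem _ ih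
  | pred l _ ih =>
    rw [← inv_smul_smul₀ (hc l) (x (l - 1)), ← hx.smul_F]
    exact N.smul_of_tower_mem _ (N.smul_mem _ ih)

lemma isSimpleModule (hinj : Function.Injective (wtK q β))
    (hx : IsWeightFamily (q := q) (m := m) α β γ x) (hc : ∀ k, eigEF q m α β γ k ≠ 0)
    (hspan : Submodule.span ℂ (Set.range x) = ⊤) (h0 : x 0 ≠ 0) :
    IsSimpleModule (Um q m) V := by
  have : Nontrivial V := ⟨x 0, 0, h0⟩
  refine { eq_bot_or_eq_top := fun N => or_iff_not_imp_left.2 fun hN => ?_ }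
  have hsum (v : V) : ∃ a : ℤ →₀ ℂ, ∑ k ∈ a.support, a k • x k = v :=
    Finsupp.mem_span_range_iff_exists_finsupp.1 (hspan ▸ Submodule.mem_top)
  obtain ⟨v, hv, hv0⟩ := N.exists_mem_ne_zero_of_ne_bot hN
  obtain ⟨a, rfl⟩ := hsum v
  obtain ⟨k, hk, -⟩ := Finset.exists_ne_zero_of_sum_ne_zero hv0
  have hxk : x k ∈ N := by
    have := N.smul_of_tower_mem (a k)⁻¹
      (smul_mem_of_sum_mem hinj (fun k => (hx.isWeight k).smul_K) N _ _ hv k hk)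
    rwa [inv_smul_smul₀ (Finsupp.mem_support_iff.1 hk)] at this
  refine eq_top_iff.2 fun w _ => ?_
  obtain ⟨b, rfl⟩ := hsum w
  exact N.sum_mem fun l _ => N.smul_of_tower_mem _ (hx.mem_of_mem hc N hxk l)

lemma not_finiteDimensional (hinj : Function.Injective (wtK q β))
    (hx : IsWeightFamily (q := q) (m := m) α β γ x) (hc : ∀ k, eigEF q m α β γ k ≠ 0)
    (h0 : x 0 ≠ 0) : ¬ FiniteDimensional ℂ V := by
  intro hfin
  have := IsScalarTower.to_smulCommClass (R := ℂ) (A := Um q m) (M := V)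
  have hne (k : ℤ) : x k ≠ 0 := fun hk =>
    h0 (by simpa using hx.mem_of_mem hc ⊥ (k := k) (by simpa using hk) 0)
  have hli : LinearIndependent ℂ x :=
    Module.End.eigenvectors_linearIndependent' (Algebra.lsmul ℂ ℂ V (uK q (fm q m)))
      (wtK q β) hinj x fun k => by
        refine ⟨Module.End.mem_eigenspace_iff.2 ?_, hne k⟩
        exact (hx.isWeight k).smul_K
  exact not_finite_iff_infinite.2 inferInstance hli.finite

end IsWeightFamily

lemma actsDiag_of_span_eq_top {x : ℤ → V} (hspan : Submodule.span ℂ (Set.range x) = ⊤)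
    {u : Um q m} {c : ℤ → ℂ} (hu : ∀ k, u • x k = c k • x k) : ActsDiag q m V u := by
  have := IsScalarTower.to_smulCommClass (R := ℂ) (A := Um q m) (M := V)
  intro v
  obtain ⟨a, rfl⟩ := Finsupp.mem_span_range_iff_exists_finsupp.1
    (show v ∈ Submodule.span ℂ (Set.range x) from hspan ▸ Submodule.mem_top)
  refine sum_mem fun k _ => AddSubgroup.subset_closure ⟨c k, ?_⟩
  rw [algebraMap_smul, smul_comm, hu, smul_comm]

end WeightVectors

section Nontriviality

/-- The operator `g ↦ (j ↦ d j * g (j + s))` on functions `ℤ → ℂ`. -/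
def weightedShift (d : ℤ → ℂ) (s : ℤ) : Module.End ℂ (ℤ → ℂ) where
  toFun g j := d j * g (j + s)
  map_add' g h := by ext j; simp [mul_add]
  map_smul' a g := by ext j; simp [mul_left_comm]

@[simp] lemma weightedShift_apply (d : ℤ → ℂ) (s : ℤ) (g : ℤ → ℂ) (j : ℤ) :
    weightedShift d s g j = d j * g (j + s) := rfl

lemma weightedShift_zero_pow (d : ℤ → ℂ) (n : ℕ) :
    weightedShift d 0 ^ n = weightedShift (d ^ n) 0 := by
  induction n with
  | zero => ext; simp
  | succ n ih => rw [pow_succ, ih]; ext; simp [pow_succ, mul_assoc]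

variable {q : ℂ} {m : ℕ} {α β γ : ℂ}

/-- The action of the generators on the weight representation `ℤ → ℂ`. -/
noncomputable def genAction (q : ℂ) (m : ℕ) (α β γ : ℂ) : Gen → Module.End ℂ (ℤ → ℂ)
  | .E => weightedShift 1 (-1)
  | .F => weightedShift (fun j => eigEF q m α β γ (j + 1)) 1
  | .K => weightedShift (wtK q β) 0
  | .Kinv => weightedShift (fun j => (wtK q β j)⁻¹) 0
  | .H => weightedShift (wtH q γ) 0
  | .Hinv => weightedShift (fun j => (wtH q γ j)⁻¹) 0

lemma genAction_rel (hq0 : q ≠ 0) (hm : q ^ (2 * m) ≠ 1) (hβ : β ≠ 0) (hγ : γ ≠ 0) {a b : FA}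
    (h : URel q (fm q m) a b) :
    FreeAlgebra.lift ℂ (genAction q m α β γ) a = FreeAlgebra.lift ℂ (genAction q m α β γ) b := by
  cases h
  case EF =>
    ext g j
    have := eigEF_eq_add (α := α) (β := β) (γ := γ) hq0 hm j
    simp only [gE, gF, gK, gH, fm, genAction, weightedShift_zero_pow, map_sub, map_mul, map_smul,
      map_pow, FreeAlgebra.lift_ι_apply, LinearMap.sub_apply, LinearMap.smul_apply, Pi.sub_apply,
      Pi.smul_apply, Module.End.mul_apply, weightedShift_apply, Pi.one_apply, Pi.pow_apply,
      neg_add_cancel_right, add_neg_cancel_right, add_zero, one_mul, smul_eq_mul]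
    linear_combination g j * this
  all_goals
    ext g j
    have := wtK_ne_zero hq0 hβ j
    have := wtH_ne_zero hq0 hγ j
    simp [gE, gF, gK, gKi, gH, gHi, genAction, ← sub_eq_add_neg, wtK_add_one hq0,
      wtH_add_one hq0, wtK_sub_one hq0, wtH_sub_one hq0]
    field_simp

/-- The weight representation of `U_q(f_m(K,H))` on `ℤ → ℂ`. -/
noncomputable def weightRep (α : ℂ) (hq0 : q ≠ 0) (hm : q ^ (2 * m) ≠ 1) (hβ : β ≠ 0)
    (hγ : γ ≠ 0) : Um q m →ₐ[ℂ] Module.End ℂ (ℤ → ℂ) :=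
  RingQuot.liftAlgHom ℂ ⟨FreeAlgebra.lift ℂ (genAction q m α β γ),
    fun _ _ h => genAction_rel hq0 hm hβ hγ h⟩

lemma one_notMem_Pinfinf (hq0 : q ≠ 0) (hm : q ^ (2 * m) ≠ 1) (hβ : β ≠ 0) (hγ : γ ≠ 0) :
    (1 : Um q m) ∉ Pinfinf q m α β γ := by
  let ρ := weightRep (m := m) α hq0 hm hβ hγ
  let v : ℤ → ℂ := Pi.single 0 1
  let A : Submodule (Um q m) (Um q m) :=
    { carrier := {u | ρ u v = 0}
      add_mem' := fun {a b} ha hb => by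
        rw [Set.mem_ofPred_eq] at *; rw [map_add, LinearMap.add_apply, ha, hb, add_zero]
      zero_mem' := by rw [Set.mem_ofPred_eq, map_zero, LinearMap.zero_apply]
      smul_mem' := fun c u hu => by
        rw [Set.mem_ofPred_eq] at *
        rw [smul_eq_mul, map_mul, Module.End.mul_apply, hu, map_zero] }
  have hle : Pinfinf q m α β γ ≤ A := by
    refine Submodule.span_le.2 ?_
    rintro u (rfl | rfl | rfl) <;> change ρ _ v = 0 <;>
    · rw [map_sub, AlgHom.commutes, LinearMap.sub_apply, sub_eq_zero]
      ext j
      rcases eq_or_ne j 0 with rfl | hj <;>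
      simp [*, ρ, weightRep, uE, uF, uK, uH, gE, gF, gK, gH, genAction, v,
        RingQuot.liftAlgHom_mkAlgHom_apply, Module.algebraMap_end_apply]
  intro h
  have h1 : ρ 1 v = 0 := hle h
  rw [map_one, Module.End.one_apply] at h1
  simpa [v] using congrFun h1 0

end Nontriviality

lemma isWeight_mk_one (q : ℂ) (m : ℕ) (α β γ : ℂ) :
    IsWeight (q := q) (m := m) α β γ 0
      (Submodule.Quotient.mk (1 : Um q m) : Um q m ⧸ Pinfinf q m α β γ) := by
  have key {u : Um q m} {a : ℂ} (h : u - algebraMap ℂ (Um q m) a ∈ Pinfinf q m α β γ) :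
      u • (Submodule.Quotient.mk (1 : Um q m) : Um q m ⧸ Pinfinf q m α β γ) =
        a • Submodule.Quotient.mk (1 : Um q m) := by
    rw [← Submodule.Quotient.mk_smul, ← Submodule.Quotient.mk_smul, Submodule.Quotient.eq,
      smul_eq_mul, mul_one, ← Algebra.algebraMap_eq_smul_one]
    exact h
  refine ⟨?_, ?_, ?_⟩
  · rw [wtK_zero]; exact key (Submodule.subset_span (by simp))
  · rw [wtH_zero]; exact key (Submodule.subset_span (by simp))
  · rw [eigEF_zero, smul_smul]; exact key (Submodule.subset_span (by simp))

/-- If for every `n ≥ 0`,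
`α ≠ -(1/(q - q⁻¹))·((q^{-2m}(1 - q^{-2nm})/(1 - q^{-2m}))β^m - (q^{2m}(1 - q^{2nm})/(1 - q^{2m}))γ^m)`,
and for every `n ≥ 1`,
`α ≠ (1/(q - q⁻¹))·(((1 - q^{2nm})/(1 - q^{2m}))β^m - ((1 - q^{-2nm})/(1 - q^{-2m}))γ^m)`,
then `U/P_{∞,∞}` is an infinite-dimensional irreducible weight representation of
`U = U_q(f_m(K,H))`, i.e. `K` and `H` act semisimply on it. -/
theorem stmt5 (q : ℂ) (hq0 : q ≠ 0) (hq : ∀ n : ℕ, 0 < n → q ^ n ≠ 1)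
    (m : ℕ) (hm : 1 ≤ m) (α β γ : ℂ) (hβ : β ≠ 0) (hγ : γ ≠ 0)
    (h1 : ∀ n : ℕ,
      α ≠ -((q - q⁻¹)⁻¹ *
        (q ^ (-(2 * (m : ℤ))) * (1 - q ^ (-(2 * (n : ℤ) * m))) / (1 - q ^ (-(2 * (m : ℤ))))
            * β ^ m -
         q ^ (2 * m) * (1 - q ^ (2 * n * m)) / (1 - q ^ (2 * m)) * γ ^ m)))
    (h2 : ∀ n : ℕ, 1 ≤ n →
      α ≠ (q - q⁻¹)⁻¹ *
        ((1 - q ^ (2 * n * m)) / (1 - q ^ (2 * m)) * β ^ m -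
         (1 - q ^ (-(2 * (n : ℤ) * m))) / (1 - q ^ (-(2 * (m : ℤ)))) * γ ^ m)) :
    ¬ FiniteDimensional ℂ (Um q m ⧸ Pinfinf q m α β γ) ∧
    IsSimpleModule (Um q m) (Um q m ⧸ Pinfinf q m α β γ) ∧
    ActsDiag q m (Um q m ⧸ Pinfinf q m α β γ) (uK q (fm q m)) ∧
    ActsDiag q m (Um q m ⧸ Pinfinf q m α β γ) (uH q (fm q m)) := by
  have hQ : q ^ (2 * m) ≠ 1 := hq _ (by omega)
  have hc : ∀ k, eigEF q m α β γ k ≠ 0 := eigEF_ne_zero hq0 hQ h1 h2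
  have hinj : Function.Injective (wtK q β) := wtK_injective hq0 hq hβ
  obtain ⟨x, hx0, hx⟩ := exists_isWeightFamily hq0 hQ hc (isWeight_mk_one q m α β γ)
  have hne : x 0 ≠ 0 := by
    rw [hx0, Ne, Submodule.Quotient.mk_eq_zero]
    exact one_notMem_Pinfinf hq0 hQ hβ hγ
  have hspan : Submodule.span ℂ (Set.range x) = ⊤ := by
    refine hx.span_eq_top hq0 hβ hγ fun v => ?_
    obtain ⟨u, rfl⟩ := Submodule.Quotient.mk_surjective _ v
    exact ⟨u, by rw [hx0, ← Submodule.Quotient.mk_smul, smul_eq_mul, mul_one]⟩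
  exact ⟨hx.not_finiteDimensional hinj hc hne, hx.isSimpleModule hinj hc hspan hne,
    actsDiag_of_span_eq_top hspan fun k => (hx.isWeight k).smul_K,
    actsDiag_of_span_eq_top hspan fun k => (hx.isWeight k).smul_H⟩
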